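/- Let T be a d-tournament on vertex set [n] with d ≥ 2. If for every vertex i ∈ [n] the restriction of the link lk_T(i) to the vertex set {i+1, i+2, …, n} is acyclic, then T is acyclic. -/

import Mathlib

open Finset

/-- The induced-orientation sign `(τ;σ)`: if `τ ⊆ σ` and `|τ| + 1 = |σ|`, with
`σ = {i₀ < … < i_d}` and `τ = σ \ {i_j}`, this is `(-1)^(d - j)`; otherwise `0`. -/
def relSign (τ σ : Finset ℕ) : ℤ :=
  if τ ⊆ σ ∧ τ.card + 1 = σ.card then
    ∑ x ∈ σ \ τ, (-1 : ℤ) ^ (σ.card - 1 - (σ.filter (fun y => y < x)).card)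
  else 0

/-- A `d`-tournament on vertex set `V`: a sign `±1` for each `(d+1)`-element subset of `V`
(encoded as a function on all finsets, vanishing elsewhere).  The column of the incidence
matrix indexed by a face `F` is the function `fun τ => ε F * relSign τ F`. -/
def IsTournament (V : Finset ℕ) (d : ℕ) (ε : Finset ℕ → ℤ) : Prop :=
  ∀ σ : Finset ℕ,
    (σ ⊆ V ∧ σ.card = d + 1 → ε σ = 1 ∨ ε σ = -1) ∧
    (¬(σ ⊆ V ∧ σ.card = d + 1) → ε σ = 0)

/-- `C` is a cycle: a nonempty set of `(d+1)`-element subsets of `V` admitting positive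
real coefficients whose weighted incidence-matrix column sum vanishes. -/
def IsCycle (V : Finset ℕ) (d : ℕ) (ε : Finset ℕ → ℤ) (C : Finset (Finset ℕ)) : Prop :=
  C.Nonempty ∧ (∀ F ∈ C, F ⊆ V ∧ F.card = d + 1) ∧
    ∃ v : Finset ℕ → ℝ, (∀ F ∈ C, 0 < v F) ∧
      ∀ τ : Finset ℕ, ∑ F ∈ C, v F * ((ε F : ℝ) * (relSign τ F : ℝ)) = 0

def IsAcyclic (V : Finset ℕ) (d : ℕ) (ε : Finset ℕ → ℤ) : Prop :=
  ∀ C : Finset (Finset ℕ), ¬ IsCycle V d ε C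

/-- `a_d(n)`: the number of acyclic `d`-tournaments on vertex set `[n]`. -/
noncomputable def acyclicCount (d n : ℕ) : ℕ :=
  Nat.card {ε : Finset ℕ → ℤ //
    IsTournament (Finset.range n) d ε ∧ IsAcyclic (Finset.range n) d ε}

/-- Restriction (subtournament) of `ε` to the subsets of `S`. -/
def restrict (S : Finset ℕ) (ε : Finset ℕ → ℤ) : Finset ℕ → ℤ :=
  fun σ => if σ ⊆ S then ε σ else 0

/-- The link of the vertex `x`: it orients `τ` as the orientation induced on `τ`
by `τ ∪ {x}`. -/
def link (ε : Finset ℕ → ℤ) (x : ℕ) : Finset ℕ → ℤ :=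
  fun τ => ε (insert x τ) * relSign τ (insert x τ)

/-- The degree sequence `A · 1⃗`. -/
def degSeq (V : Finset ℕ) (d : ℕ) (ε : Finset ℕ → ℤ) : Finset ℕ → ℤ :=
  fun τ => ∑ F ∈ V.powersetCard (d + 1), ε F * relSign τ F

/-- A `0/1`-cycle: a nonempty set of faces whose incidence-matrix columns sum to zero. -/
def Is01Cycle (V : Finset ℕ) (d : ℕ) (ε : Finset ℕ → ℤ) (C : Finset (Finset ℕ)) : Prop :=
  C.Nonempty ∧ (∀ F ∈ C, F ⊆ V ∧ F.card = d + 1) ∧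
    ∀ τ : Finset ℕ, ∑ F ∈ C, ε F * relSign τ F = 0

/-- `U` is a `(d+2)`-cycle: the set of all its `(d+1)`-element subsets is a cycle. -/
def IsDCycle (V : Finset ℕ) (d : ℕ) (ε : Finset ℕ → ℤ) (U : Finset ℕ) : Prop :=
  U ⊆ V ∧ U.card = d + 2 ∧ IsCycle V d ε (U.powersetCard (d + 1))

/-- A `d`-element subset `τ` of `V` is free if all nonzero entries of its row
in the incidence matrix have the same sign. -/
def IsFree (V : Finset ℕ) (d : ℕ) (ε : Finset ℕ → ℤ) (τ : Finset ℕ) : Prop :=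
  τ ⊆ V ∧ τ.card = d ∧
    ((∀ σ ∈ V.powersetCard (d + 1), 0 ≤ ε σ * relSign τ σ) ∨
     (∀ σ ∈ V.powersetCard (d + 1), ε σ * relSign τ σ ≤ 0))

/-- An elementary collapse at a free `d`-face `τ`: all faces containing `τ` get sign `0`. -/
def CollapseStep (V : Finset ℕ) (d : ℕ) (ε ε' : Finset ℕ → ℤ) : Prop :=
  ∃ τ : Finset ℕ, IsFree V d ε τ ∧ ε' = fun σ => if τ ⊆ σ then 0 else ε σ

/-- Collapsibility: a finite sequence of elementary collapses reaching the zero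
partial tournament. -/
def Collapsible (V : Finset ℕ) (d : ℕ) (ε : Finset ℕ → ℤ) : Prop :=
  Relation.ReflTransGen (CollapseStep V d) ε (fun _ => 0)

/-- Realizability in `ℝ^d`: the orientations are induced by a general-position embedding
of the vertices, i.e. `ε σ` is the sign of the (nonzero) orientation determinant of the
points of `σ` listed in increasing order. -/
def Realizable (n d : ℕ) (ε : Finset ℕ → ℤ) : Prop :=
  ∃ ι : ℕ → Fin d → ℝ, ∀ σ : Finset ℕ, σ ⊆ Finset.range n → ∀ hσ : σ.card = d + 1,
    0 < (ε σ : ℝ) * Matrix.det (Matrix.of fun k l : Fin d =>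
      ι ((σ.orderIsoOfFin hσ) k.succ : ℕ) l - ι ((σ.orderIsoOfFin hσ) 0 : ℕ) l)

/-- Adding a new smallest vertex to both sets does not change the induced-orientation sign. -/
theorem relSign_insert_insert_of_lt {i : ℕ} {ρ τ : Finset ℕ} (hρ : i ∉ ρ) (hτ : ∀ j ∈ τ, i < j) :
    relSign (insert i ρ) (insert i τ) = relSign ρ τ := by
  have hiτ : i ∉ τ := fun h => lt_irrefl _ (hτ i h)
  have hsdiff : insert i τ \ insert i ρ = τ \ ρ := by
    ext x
    simp only [mem_sdiff, mem_insert]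
    grind
  unfold relSign
  rw [card_insert_of_notMem hρ, card_insert_of_notMem hiτ, hsdiff]
  refine if_congr (by rw [insert_subset_insert_iff hρ, add_left_inj]) (sum_congr rfl fun x hx => ?_) rfl
  rw [filter_insert, if_pos (hτ x (mem_sdiff.1 hx).1), card_insert_of_notMem (by simp [hiτ])]
  congr 1
  omega

theorem relSign_self_insert_of_lt {i : ℕ} {τ : Finset ℕ} (hτ : ∀ j ∈ τ, i < j) :
    relSign τ (insert i τ) = (-1) ^ τ.card := by
  have hiτ : i ∉ τ := fun h => lt_irrefl _ (hτ i h)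
  have hsdiff : insert i τ \ τ = {i} := by
    ext x
    simp only [mem_sdiff, mem_insert, mem_singleton]
    grind
  have hfilter : (insert i τ).filter (fun y => y < i) = ∅ := by
    ext x
    simp only [mem_filter, mem_insert, notMem_empty, iff_false]
    grind
  unfold relSign
  rw [if_pos ⟨subset_insert i τ, (card_insert_of_notMem hiτ).symm⟩, hsdiff, sum_singleton,
    hfilter, card_insert_of_notMem hiτ]
  simp

theorem relSign_eq_zero_of_not_subset {τ σ : Finset ℕ} (h : ¬ τ ⊆ σ) : relSign τ σ = 0 :=
  if_neg fun h' => h h'.1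

/-- if for every vertex `i` the restriction of the link of `i`
to `{i+1, …, n}` is acyclic, then `T` is acyclic. -/
theorem acyclic_of_links_acyclic (n d : ℕ) (hd : 2 ≤ d) (ε : Finset ℕ → ℤ)
    (hT : IsTournament (Finset.range n) d ε)
    (hlinks : ∀ i ∈ Finset.range n,
      IsAcyclic ((Finset.range n).filter (fun j => i < j)) (d - 1)
        (restrict ((Finset.range n).filter (fun j => i < j)) (link ε i))) :
    IsAcyclic (Finset.range n) d ε := by
  rintro C ⟨⟨F₀, hF₀⟩, hC, v, hv, hsum⟩
  have hne : (C.biUnion id).Nonempty := by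
    have : F₀.Nonempty := card_pos.1 (by rw [(hC F₀ hF₀).2]; omega)
    exact this.mono (subset_biUnion_of_mem id hF₀)
  obtain ⟨i, hi, hmin⟩ := exists_min_image (C.biUnion id) id hne
  obtain ⟨F₁, hF₁, hiF₁⟩ := mem_biUnion.1 hi
  simp only [id] at hiF₁ hmin
  have hlt : ∀ F ∈ C, ∀ j ∈ F.erase i, i < j := fun F hF j hj =>
    lt_of_le_of_ne (hmin j (mem_biUnion.2 ⟨F, hF, mem_of_mem_erase hj⟩)) (ne_of_mem_erase hj).symm
  have hsub : ∀ F ∈ C, F.erase i ⊆ (range n).filter (fun j => i < j) := fun F hF j hj =>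
    mem_filter.2 ⟨(hC F hF).1 (mem_of_mem_erase hj), hlt F hF j hj⟩
  have hcard : ∀ F ∈ C, i ∈ F → (F.erase i).card = d := fun F hF hiF => by
    rw [card_erase_of_mem hiF, (hC F hF).2, Nat.add_sub_cancel]
  refine hlinks i ((hC F₁ hF₁).1 hiF₁) ((C.filter (i ∈ ·)).image (·.erase i))
    ⟨⟨_, mem_image_of_mem _ (mem_filter.2 ⟨hF₁, hiF₁⟩)⟩, ?_, fun τ => v (insert i τ), ?_, ?_⟩
  · simp only [mem_image, mem_filter]
    rintro _ ⟨F, ⟨hF, hiF⟩, rfl⟩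
    exact ⟨hsub F hF, by rw [hcard F hF hiF]; omega⟩
  · simp only [mem_image, mem_filter]
    rintro _ ⟨F, ⟨hF, hiF⟩, rfl⟩
    rw [insert_erase hiF]
    exact hv F hF
  · intro ρ
    have hinj : Set.InjOn (fun F : Finset ℕ => F.erase i) (C.filter (i ∈ ·)) := by
      intro F hF G hG h
      have h' : F.erase i = G.erase i := h
      rw [← insert_erase (mem_filter.1 hF).2, h', insert_erase (mem_filter.1 hG).2]
    rw [sum_image hinj]
    by_cases hρ : i ∈ ρ
    · refine sum_eq_zero fun F _ => ?_
      rw [relSign_eq_zero_of_not_subset fun h => notMem_erase i F (h hρ)]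
      simp
    · have hrow := hsum (insert i ρ)
      rw [← sum_filter_of_ne (p := (i ∈ ·))] at hrow
      · rw [← mul_zero ((-1 : ℝ) ^ d), ← hrow, mul_sum]
        refine sum_congr rfl fun F hF => ?_
        obtain ⟨hFC, hiF⟩ := mem_filter.1 hF
        have hself := relSign_self_insert_of_lt (hlt F hFC)
        have hins := relSign_insert_insert_of_lt hρ (hlt F hFC)
        rw [hcard F hFC hiF] at hself
        rw [_root_.restrict, if_pos (hsub F hFC), link, hself, ← hins]
        simp only [insert_erase hiF]
        push_cast
        ring
      · intro F _ hF0
        by_contra hiF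
        refine hF0 ?_
        rw [relSign_eq_zero_of_not_subset fun h => hiF (h (mem_insert_self i ρ))]
        simp
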